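/- Let d ≥ 2, let K be a number field, let c ∈ K^×, and let φ(x) = x^d + c. Suppose that every K-rational preperiodic point of φ is either 0 or a root of unity. If φ has a K-rational point of exact period 3, then there exist ω₃ ∈ μ_K and a primitive 6th root of unity ζ₆ ∈ K such that: d ≡ 1 (mod 6), ω₃^{d−1} = ζ₆², c = ω₃, the 3-cycle is 0 ↦ ω₃ ↦ ζ₆ω₃ ↦ 0, and moreover PrePer(φ, K) = {0} ∪ {ζω₃ : ζ ∈ μ_{K,d}} ∪ {ζ·ζ₆ω₃ : ζ ∈ μ_{K,d}}. Conversely, if d ≡ 1 (mod 6), ω₃ ∈ μ_K satisfies ω₃^{d−1} = ζ₆², and c = ω₃, then {0, ω₃, ζ₆ω₃} is a 3-cycle for φ. -/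

import Mathlib

noncomputable section

/-- orbit-finiteness definition of preperiodicity -/
def Preperiodic {K : Type*} (φ : K → K) (α : K) : Prop :=
  (Set.range fun n : ℕ => φ^[n] α).Finite

/-- The set `μ_K` of roots of unity of `K`. -/
def rootsOfUnitySet (K : Type*) [Field K] : Set K :=
  {ζ : K | ∃ n : ℕ, 0 < n ∧ ζ ^ n = 1}

open Function Polynomial

theorem Preperiodic.apply {K : Type*} {φ : K → K} {α : K} (h : Preperiodic φ α) :
    Preperiodic φ (φ α) := by
  refine Set.Finite.subset h ?_
  rintro _ ⟨n, rfl⟩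
  exact ⟨n + 1, iterate_succ_apply φ n α⟩

theorem Preperiodic.of_apply {K : Type*} {φ : K → K} {α : K} (h : Preperiodic φ (φ α)) :
    Preperiodic φ α := by
  refine Set.Finite.subset (Set.Finite.insert α h) ?_
  rintro _ ⟨n, rfl⟩
  cases n with
  | zero => exact Or.inl rfl
  | succ n => exact Or.inr ⟨n, (iterate_succ_apply φ n α).symm⟩

theorem Preperiodic.of_minimalPeriod_pos {K : Type*} {φ : K → K} {α : K}
    (h : 0 < minimalPeriod φ α) : Preperiodic φ α := by
  refine Set.Finite.subset ((Set.finite_lt_nat (minimalPeriod φ α)).image fun n => φ^[n] α) ?_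
  rintro _ ⟨n, rfl⟩
  exact ⟨n % minimalPeriod φ α, Nat.mod_lt _ h, iterate_mod_minimalPeriod_eq⟩

theorem one_mem_rootsOfUnitySet (K : Type*) [Field K] : (1 : K) ∈ rootsOfUnitySet K :=
  ⟨1, one_pos, one_pow 1⟩

theorem pow_mem_rootsOfUnitySet {K : Type*} [Field K] {x : K} (hx : x ∈ rootsOfUnitySet K)
    (k : ℕ) : x ^ k ∈ rootsOfUnitySet K := by
  obtain ⟨n, hn, h⟩ := hx
  exact ⟨n, hn, by rw [pow_right_comm, h, one_pow]⟩

theorem neg_mem_rootsOfUnitySet {K : Type*} [Field K] {x : K} (hx : x ∈ rootsOfUnitySet K) :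
    -x ∈ rootsOfUnitySet K := by
  obtain ⟨n, hn, h⟩ := hx
  exact ⟨2 * n, by omega, by rw [pow_mul, neg_sq, ← pow_mul, mul_comm, pow_mul, h, one_pow]⟩

theorem div_mem_rootsOfUnitySet {K : Type*} [Field K] {x y : K} (hx : x ∈ rootsOfUnitySet K)
    (hy : y ∈ rootsOfUnitySet K) : x / y ∈ rootsOfUnitySet K := by
  obtain ⟨n, hn, hx⟩ := hx
  obtain ⟨m, hm, hy⟩ := hy
  refine ⟨n * m, Nat.mul_pos hn hm, ?_⟩
  rw [div_pow, pow_mul, hx, mul_comm n m, pow_mul, hy, one_pow, one_pow, div_one]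

theorem ne_zero_of_mem_rootsOfUnitySet {K : Type*} [Field K] {x : K}
    (hx : x ∈ rootsOfUnitySet K) : x ≠ 0 := by
  obtain ⟨n, hn, h⟩ := hx
  rintro rfl
  simp [hn.ne'] at h

theorem conj_eq_inv_of_mem_rootsOfUnitySet {K : Type*} [Field K] (σ : K →+* ℂ) {x : K}
    (hx : x ∈ rootsOfUnitySet K) : (starRingEnd ℂ) (σ x) = (σ x)⁻¹ := by
  obtain ⟨n, hn, h⟩ := hx
  have hn1 : ‖σ x‖ = 1 :=
    Complex.norm_eq_one_of_pow_eq_one (by rw [← map_pow, h, map_one]) hn.ne'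
  exact (Complex.inv_eq_conj hn1).symm

/-- A nonzero sum of two roots of unity determines their product. -/
theorem mul_eq_mul_of_add_eq_add {K : Type*} [Field K] [NumberField K] {x y z w : K}
    (hx : x ∈ rootsOfUnitySet K) (hy : y ∈ rootsOfUnitySet K) (hz : z ∈ rootsOfUnitySet K)
    (hw : w ∈ rootsOfUnitySet K) (h : x + y = z + w) (h0 : x + y ≠ 0) : x * y = z * w := by
  obtain ⟨σ⟩ : Nonempty (K →+* ℂ) := inferInstance
  have key := congrArg (fun t => (starRingEnd ℂ) (σ t)) h
  simp only [map_add, conj_eq_inv_of_mem_rootsOfUnitySet σ, hx, hy, hz, hw, ← map_inv₀] at key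
  simp only [← map_add] at key
  replace key := σ.injective key
  have hx0 := ne_zero_of_mem_rootsOfUnitySet hx
  have hy0 := ne_zero_of_mem_rootsOfUnitySet hy
  have hz0 := ne_zero_of_mem_rootsOfUnitySet hz
  have hw0 := ne_zero_of_mem_rootsOfUnitySet hw
  field_simp at key
  apply mul_left_cancel₀ h0
  linear_combination x * y * h - key

theorem sq_add_self_add_one_eq_zero {K : Type*} [Field K] [NumberField K] {u : K}
    (hu : u ∈ rootsOfUnitySet K) (hv : 1 + u ∈ rootsOfUnitySet K) : u ^ 2 + u + 1 = 0 := by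
  obtain ⟨σ⟩ : Nonempty (K →+* ℂ) := inferInstance
  have key := conj_eq_inv_of_mem_rootsOfUnitySet σ hv
  rw [map_add, map_add, conj_eq_inv_of_mem_rootsOfUnitySet σ hu, ← map_inv₀, ← map_add,
    ← map_inv₀] at key
  simp only [map_one] at key
  rw [← map_one σ, ← map_add] at key
  replace key := σ.injective key
  have hu0 := ne_zero_of_mem_rootsOfUnitySet hu
  have hv0 := ne_zero_of_mem_rootsOfUnitySet hv
  field_simp at key
  linear_combination key

/-- Three distinct roots of unity never form a cycle of `x ↦ x ^ d + c` when `c ≠ 0`. -/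
theorem not_three_cycle_of_mem_rootsOfUnitySet {K : Type*} [Field K] [NumberField K] {d : ℕ}
    {c x y z : K} (hc : c ≠ 0) (hx : x ∈ rootsOfUnitySet K) (hy : y ∈ rootsOfUnitySet K)
    (hz : z ∈ rootsOfUnitySet K) (hxy : x ^ d + c = y) (hyz : y ^ d + c = z)
    (hzx : z ^ d + c = x) (h₁ : x ≠ y) (h₂ : y ≠ z) (h₃ : z ≠ x) : False := by
  have hx' := neg_mem_rootsOfUnitySet (pow_mem_rootsOfUnitySet hx d)
  have hy' := neg_mem_rootsOfUnitySet (pow_mem_rootsOfUnitySet hy d)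
  have hz' := neg_mem_rootsOfUnitySet (pow_mem_rootsOfUnitySet hz d)
  have e₁ : y + -x ^ d = c := by linear_combination -hxy
  have e₂ : z + -y ^ d = c := by linear_combination -hyz
  have e₃ : x + -z ^ d = c := by linear_combination -hzx
  have p₁ := mul_eq_mul_of_add_eq_add hy hx' hz hy' (e₁.trans e₂.symm) (e₁.trans_ne hc)
  have p₂ := mul_eq_mul_of_add_eq_add hy hx' hx hz' (e₁.trans e₃.symm) (e₁.trans_ne hc)
  have q₁ : y + z = c := by
    apply mul_left_cancel₀ (sub_ne_zero.2 h₂)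
    linear_combination y * e₁ - z * e₂ - p₁
  have q₂ : y + x = c := by
    apply mul_left_cancel₀ (sub_ne_zero.2 h₁.symm)
    linear_combination y * e₁ - x * e₃ - p₂
  exact h₃ (by linear_combination q₁ - q₂)

theorem isPrimitiveRoot_six_iff {K : Type*} [Field K] [CharZero K] {ζ : K} :
    IsPrimitiveRoot ζ 6 ↔ ζ ^ 2 - ζ + 1 = 0 := by
  have : NeZero ((6 : ℕ) : K) := ⟨by norm_num⟩
  rw [← isRoot_cyclotomic_iff, cyclotomic_six]
  simp [IsRoot]

theorem three_cycle_zero {K : Type*} [Field K] [CharZero K] {d : ℕ} (hd : 2 ≤ d) {ω ζ : K}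
    (hmod : d % 6 = 1) (hζ : IsPrimitiveRoot ζ 6) (hω : ω ^ (d - 1) = ζ ^ 2) :
    ω ^ d + ω = ζ * ω ∧ (ζ * ω) ^ d + ω = 0 := by
  have h6 := isPrimitiveRoot_six_iff.1 hζ
  have hωd : ω ^ d = ζ ^ 2 * ω := by rw [← hω, ← pow_succ]; congr 1; omega
  have hζd : ζ ^ d = ζ := by
    rw [← Nat.div_add_mod d 6, hmod, pow_add, pow_mul, hζ.pow_eq_one, one_pow, one_mul, pow_one]
  constructor
  · linear_combination hωd + ω * h6
  · rw [mul_pow, hωd, hζd]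
    linear_combination (ζ * ω + ω) * h6

theorem exists_primitive_six_of_period_three {K : Type*} [Field K] [NumberField K] {d : ℕ}
    (hd : 2 ≤ d) {c : K} (hc : c ∈ rootsOfUnitySet K) (hfc : c ^ d + c ∈ rootsOfUnitySet K)
    (h0 : (c ^ d + c) ^ d + c = 0) :
    ∃ ζ : K, IsPrimitiveRoot ζ 6 ∧ d % 6 = 1 ∧ c ^ (d - 1) = ζ ^ 2 := by
  have hc0 := ne_zero_of_mem_rootsOfUnitySet hc
  have hcd : c ^ d = c ^ (d - 1) * c := by rw [← pow_succ]; congr 1; omega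
  have hu := pow_mem_rootsOfUnitySet hc (d - 1)
  have hv : 1 + c ^ (d - 1) ∈ rootsOfUnitySet K := by
    have := div_mem_rootsOfUnitySet hfc hc
    rwa [hcd, ← add_one_mul, mul_div_cancel_right₀ _ hc0, add_comm] at this
  have hu3 := sq_add_self_add_one_eq_zero hu hv
  set u := c ^ (d - 1)
  have hζ : IsPrimitiveRoot (1 + u) 6 :=
    isPrimitiveRoot_six_iff.2 (by linear_combination hu3)
  have hsq : u = (1 + u) ^ 2 := by linear_combination -hu3
  refine ⟨1 + u, hζ, ?_, hsq⟩
  have h3 : (1 + u) ^ 3 = -1 := by linear_combination (u + 2) * hu3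
  have hpow : (1 + u) ^ (d + 5) = (1 + u) ^ 0 := by
    have e : (1 + u) ^ d * u = -1 := by
      apply mul_right_cancel₀ hc0
      have : c ^ d + c = (1 + u) * c := by rw [hcd]; ring
      rw [this, mul_pow, hcd] at h0
      linear_combination h0
    rw [pow_add, show (1 + u) ^ 5 = (1 + u) ^ 3 * (1 + u) ^ 2 by ring, h3, ← hsq]
    linear_combination -e
  rw [pow_zero, hζ.pow_eq_one_iff_dvd] at hpow
  omega

theorem preperiodic_eq {K : Type*} [Field K] [NumberField K] {d : ℕ} (hd : 2 ≤ d) {ω ζ : K}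
    (hω : ω ∈ rootsOfUnitySet K)
    (hprep : ∀ α : K, Preperiodic (fun x : K => x ^ d + ω) α → α = 0 ∨ α ∈ rootsOfUnitySet K)
    (hmod : d % 6 = 1) (hζ : IsPrimitiveRoot ζ 6) (hωζ : ω ^ (d - 1) = ζ ^ 2)
    (h0 : Preperiodic (fun x : K => x ^ d + ω) 0) :
    {α : K | Preperiodic (fun x : K => x ^ d + ω) α} =
      {0} ∪ {x : K | ∃ ξ : K, ξ ^ d = 1 ∧ x = ξ * ω} ∪
        {x : K | ∃ ξ : K, ξ ^ d = 1 ∧ x = ξ * (ζ * ω)} := by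
  obtain ⟨f₁, f₂⟩ := three_cycle_zero hd hmod hζ hωζ
  have hω0 := ne_zero_of_mem_rootsOfUnitySet hω
  have hζ0 : ζ ≠ 0 := hζ.ne_zero (by norm_num)
  have hd0 : d ≠ 0 := by omega
  have h6 := isPrimitiveRoot_six_iff.1 hζ
  have hroot {x y : K} (hy : y ≠ 0) (h : x ^ d = y ^ d) : ∃ ξ : K, ξ ^ d = 1 ∧ x = ξ * y :=
    ⟨x / y, by rw [div_pow, h, div_self (pow_ne_zero d hy)], (div_mul_cancel₀ x hy).symm⟩
  ext x
  simp only [Set.mem_ofPred_eq, Set.mem_union, Set.mem_singleton_iff]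
  constructor
  · intro hx
    by_cases hx0 : x = 0
    · exact Or.inl (Or.inl hx0)
    have hxr := (hprep x hx).resolve_left hx0
    rcases hprep _ hx.apply with hy | hy
    · exact Or.inr (hroot (mul_ne_zero hζ0 hω0) (by linear_combination hy - f₂))
    · refine Or.inl (Or.inr (hroot hω0 ?_))
      have hu := div_mem_rootsOfUnitySet (pow_mem_rootsOfUnitySet hxr d) hω
      have hv := div_mem_rootsOfUnitySet hy hω
      have hxu : x ^ d = x ^ d / ω * ω := (div_mul_cancel₀ _ hω0).symm
      rw [add_div, div_self hω0, add_comm] at hv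
      have hu3 := sq_add_self_add_one_eq_zero hu hv
      set u := x ^ d / ω
      have hfac : (u - ζ ^ 2) * (u + ζ) = 0 := by
        linear_combination hu3 + (-u - ζ - 1) * h6
      rcases mul_eq_zero.1 hfac with h | h
      · linear_combination hxu + ω * h - f₁ + ω * h6
      · -- then the second iterate of `x` is `(1 + ζ) * ω`, which is not a root of unity
        exfalso
        have hy1 : x ^ d + ω = (1 - ζ) * ω := by linear_combination hxu + ω * h
        have hy2 : (x ^ d + ω) ^ d + ω = (1 + ζ) * ω := by
          have hinv : (1 - ζ) * ζ = 1 := by linear_combination -h6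
          have hz : (1 - ζ) ^ d * ζ ^ d = 1 := by rw [← mul_pow, hinv, one_pow]
          have hζd : ζ ^ d = ζ := by
            rw [← Nat.div_add_mod d 6, hmod, pow_add, pow_mul, hζ.pow_eq_one, one_pow, one_mul,
              pow_one]
          rw [hζd] at hz
          have hz' : (1 - ζ) ^ d = 1 - ζ :=
            mul_right_cancel₀ hζ0 (hz.trans hinv.symm)
          rw [hy1, mul_pow, hz']
          linear_combination (1 - ζ) * f₁ - ω * h6
        have hζr : ζ ∈ rootsOfUnitySet K := ⟨6, by norm_num, hζ.pow_eq_one⟩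
        have key := hprep _ hx.apply.apply
        simp only [hy2] at key
        have hne : ζ ^ 2 + ζ + 1 ≠ 0 := fun h' =>
          mul_ne_zero two_ne_zero hζ0 (by linear_combination h' - h6)
        rcases key with hk | hk
        · have := (mul_eq_zero.1 hk).resolve_right hω0
          have h3 : (3 : K) = 0 := by linear_combination h6 + (2 - ζ) * this
          norm_num at h3
        · have := div_mem_rootsOfUnitySet hk hω
          rw [mul_div_cancel_right₀ _ hω0] at this
          exact hne (sq_add_self_add_one_eq_zero hζr this)
  · have hp₁ : Preperiodic (fun x : K => x ^ d + ω) (ω ^ d + ω) := by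
      have := h0.apply.apply
      simpa [zero_pow hd0] using this
    rintro ((rfl | ⟨ξ, hξ, rfl⟩) | ⟨ξ, hξ, rfl⟩)
    · exact h0
    · apply Preperiodic.of_apply
      simpa only [mul_pow ξ, hξ, one_mul] using hp₁
    · apply Preperiodic.of_apply
      simpa only [mul_pow ξ, hξ, one_mul, f₂] using h0

/-- A point of exact period `3` whose cycle consists of zero and roots of unity has `0` in its
cycle. -/
theorem zero_mem_of_minimalPeriod_eq_three {K : Type*} [Field K] [NumberField K] {d : ℕ} {c : K}
    (hc : c ≠ 0)
    (hprep : ∀ α : K, Preperiodic (fun x : K => x ^ d + c) α → α = 0 ∨ α ∈ rootsOfUnitySet K)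
    {α : K} (hα : minimalPeriod (fun x : K => x ^ d + c) α = 3) :
    ∃ k ≤ 3, (fun x : K => x ^ d + c)^[k] α = 0 := by
  set f := fun x : K => x ^ d + c with hf
  have hp : Preperiodic f α := .of_minimalPeriod_pos (by omega)
  have h3 : f^[3] α = α := by rw [← hα, iterate_minimalPeriod]
  have hinj {m n : ℕ} (hm : m < 3) (hn : n < 3) (h : f^[m] α = f^[n] α) : m = n :=
    (iterate_eq_iterate_iff_of_lt_minimalPeriod (hm.trans_eq hα.symm) (hn.trans_eq hα.symm)).1 h
  rcases hprep _ hp with h | hx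
  · exact ⟨0, by omega, h⟩
  rcases hprep _ hp.apply with h | hy
  · exact ⟨1, by omega, h⟩
  rcases hprep _ hp.apply.apply with h | hz
  · exact ⟨2, by omega, h⟩
  exact (not_three_cycle_of_mem_rootsOfUnitySet hc hx hy hz rfl rfl h3
    (fun h => absurd (hinj (m := 0) (n := 1) (by omega) (by omega) h) (by omega))
    (fun h => absurd (hinj (m := 1) (n := 2) (by omega) (by omega) h) (by omega))
    (fun h => absurd (hinj (m := 2) (n := 0) (by omega) (by omega) h) (by omega))).elim

/-- **Classification of rational 3-cycles** (Proposition 4.7).  Let `d ≥ 2`, let `K`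
be a number field, `c ∈ K^×`, `φ(x) = x ^ d + c`, and suppose every `K`-rational
preperiodic point of `φ` is `0` or a root of unity.  If `φ` has a `K`-rational point
of exact period `3`, then there are `ω₃ ∈ μ_K` and a primitive 6th root of unity
`ζ₆ ∈ K` with `d ≡ 1 (mod 6)`, `ω₃^{d−1} = ζ₆²`, `c = ω₃`, with 3-cycle
`0 ↦ ω₃ ↦ ζ₆ω₃ ↦ 0`, and
`PrePer(φ, K) = {0} ∪ {ζω₃ : ζ ∈ μ_{K,d}} ∪ {ζ·ζ₆ω₃ : ζ ∈ μ_{K,d}}`.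
Conversely, if `d ≡ 1 (mod 6)`, `ω₃ ∈ μ_K` satisfies `ω₃^{d−1} = ζ₆²` for a primitive
6th root of unity `ζ₆`, and `c = ω₃`, then `{0, ω₃, ζ₆ω₃}` is a 3-cycle for `φ`. -/
theorem three_cycle_classification
    {K : Type*} [Field K] [NumberField K] (d : ℕ) (hd : 2 ≤ d) (c : K) (hc : c ≠ 0)
    (hprep : ∀ α : K, Preperiodic (fun x : K => x ^ d + c) α →
      α = 0 ∨ α ∈ rootsOfUnitySet K) :
    ((∀ α : K, Function.minimalPeriod (fun x : K => x ^ d + c) α = 3 →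
      ∃ ω₃ ζ₆ : K, ω₃ ∈ rootsOfUnitySet K ∧ IsPrimitiveRoot ζ₆ 6 ∧
        α ∈ ({0, ω₃, ζ₆ * ω₃} : Set K) ∧
        d % 6 = 1 ∧
        ω₃ ^ (d - 1) = ζ₆ ^ 2 ∧
        c = ω₃ ∧
        (fun x : K => x ^ d + c) 0 = ω₃ ∧
        (fun x : K => x ^ d + c) ω₃ = ζ₆ * ω₃ ∧
        (fun x : K => x ^ d + c) (ζ₆ * ω₃) = 0 ∧
        {α : K | Preperiodic (fun x : K => x ^ d + c) α} =
          {0} ∪ {x : K | ∃ ζ : K, ζ ^ d = 1 ∧ x = ζ * ω₃} ∪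
            {x : K | ∃ ζ : K, ζ ^ d = 1 ∧ x = ζ * (ζ₆ * ω₃)})) ∧
    (∀ ω₃ ζ₆ : K, d % 6 = 1 → ω₃ ∈ rootsOfUnitySet K → IsPrimitiveRoot ζ₆ 6 →
      ω₃ ^ (d - 1) = ζ₆ ^ 2 → c = ω₃ →
      (fun x : K => x ^ d + c) 0 = ω₃ ∧
      (fun x : K => x ^ d + c) ω₃ = ζ₆ * ω₃ ∧
      (fun x : K => x ^ d + c) (ζ₆ * ω₃) = 0 ∧
      Function.minimalPeriod (fun x : K => x ^ d + c) 0 = 3) := by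
  have hd0 : d ≠ 0 := by omega
  have f0 : (fun x : K => x ^ d + c) 0 = c := by simp [hd0]
  refine ⟨fun α hα => ?_, ?_⟩
  · obtain ⟨k, hk, hkα⟩ := zero_mem_of_minimalPeriod_eq_three hc hprep hα
    set f := fun x : K => x ^ d + c with hf
    have hper : α ∈ periodicPts f := minimalPeriod_pos_iff_mem_periodicPts.1 (by omega)
    have h0 : minimalPeriod f 0 = 3 := by rw [← hkα, minimalPeriod_apply_iterate hper, hα]
    have hα0 : α = f^[3 - k] 0 := by
      rw [← hkα, ← iterate_add_apply, Nat.sub_add_cancel hk, ← hα, iterate_minimalPeriod]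
    have hp : Preperiodic f 0 := .of_minimalPeriod_pos (by omega)
    have hf3 : f (f c) = 0 := by
      have := iterate_minimalPeriod (f := f) (x := (0 : K))
      rw [h0] at this
      rwa [← f0]
    have hf2 : f c ≠ 0 := fun h => by
      have : IsPeriodicPt f 2 0 := by
        change f (f 0) = 0
        rw [f0, h]
      have := this.minimalPeriod_le two_pos
      omega
    have hcr : c ∈ rootsOfUnitySet K :=
      (hprep c (by simpa only [f0] using hp.apply)).resolve_left hc
    have hfcr : f c ∈ rootsOfUnitySet K :=
      (hprep _ (by simpa only [f0] using hp.apply.apply)).resolve_left hf2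
    obtain ⟨ζ, hζ, hmod, hcζ⟩ := exists_primitive_six_of_period_three hd hcr hfcr hf3
    obtain ⟨f₁, f₂⟩ := three_cycle_zero hd hmod hζ hcζ
    refine ⟨c, ζ, hcr, hζ, ?_, hmod, hcζ, rfl, f0, f₁, f₂,
      preperiodic_eq hd hcr hprep hmod hζ hcζ hp⟩
    have hf1 : f c = ζ * c := f₁
    interval_cases k
    · left; exact hkα
    · right; right
      change α = f (f 0) at hα0
      rwa [f0, hf1] at hα0
    · right; left
      change α = f 0 at hα0
      rwa [f0] at hα0
    · left; exact hα0
  · rintro ω ζ hmod - hζ hωζ rfl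
    obtain ⟨f₁, f₂⟩ := three_cycle_zero hd hmod hζ hωζ
    refine ⟨f0, f₁, f₂, ?_⟩
    have : Fact (Nat.Prime 3) := ⟨Nat.prime_three⟩
    refine minimalPeriod_eq_prime ?_ ?_
    · change ((0 ^ d + c) ^ d + c) ^ d + c = 0
      rw [zero_pow hd0, zero_add, f₁, f₂]
    · exact fun h => hc (f0.symm.trans h)

end
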